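/- Let H be a finite-dimensional Hopf algebra and J a left twist for H (an invertible J ∈ H⊗H with (J⊗1)·(Δ⊗id)(J) = (1⊗J)·(id⊗Δ)(J) and (ε⊗id)(J) = (id⊗ε)(J) = 1). Then exp₀(H^J) = exp₀(H), where H^J is the twisted Hopf algebra with Δ^J(h) = J Δ(h) J^{-1}. -/

import Mathlib

open TensorProduct

noncomputable section

variable (k H : Type*) [CommRing k] [Ring H] [Bialgebra k H]

/-- Convolution product `f * g = m ∘ (f ⊗ g) ∘ Δ` on linear endomorphisms. -/
def conv (f g : Module.End k H) : Module.End k H :=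
  LinearMap.mul' k H ∘ₗ TensorProduct.map f g ∘ₗ Coalgebra.comul

/-- The convolution unit `u ∘ ε`. -/
def convOne : Module.End k H := (Algebra.linearMap k H) ∘ₗ Coalgebra.counit

/-- `convSeq F n = m_n ∘ (F 0 ⊗ F 1 ⊗ ⋯ ⊗ F (n-1)) ∘ Δ_n` (as an iterated convolution). -/
def convSeq : (ℕ → Module.End k H) → ℕ → Module.End k H
  | _, 0 => convOne k H
  | F, n + 1 => conv k H (F 0) (convSeq (fun j => F (j + 1)) n)

/-- The `n`-th Sweedler power `[n] = m_n ∘ Δ_n` as a linear endomorphism. -/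
def sweedlerPow (n : ℕ) : Module.End k H := convSeq k H (fun _ => LinearMap.id) n

/-- The twisted Sweedler power `m_n ∘ (id ⊗ T ⊗ T² ⊗ ⋯ ⊗ T^(n-1)) ∘ Δ_n`. -/
def twistPow (T : Module.End k H) (n : ℕ) : Module.End k H :=
  convSeq k H (fun j => T ^ j) n

/-- `exp₀(H)`: the least `n ≥ 1` with `[n] = u ∘ ε`, in `ℕ ∪ {∞}` (`sInf ∅ = ∞`). -/
def exp0 : ℕ∞ :=
  sInf {e : ℕ∞ | ∃ n : ℕ, e = n ∧ 0 < n ∧ sweedlerPow k H n = convOne k H}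

/-- The `T`-twisted exponent: least `n ≥ 1` with
`m_n ∘ (id ⊗ T ⊗ ⋯ ⊗ T^(n-1)) ∘ Δ_n = u ∘ ε`, in `ℕ ∪ {∞}`.  For `T = S⁻²` this is
`exp(H)` and for `T = S^(2i)` this is the twisted exponent `exp_{2i}(H)`. -/
def expAt (T : Module.End k H) : ℕ∞ :=
  sInf {e : ℕ∞ | ∃ n : ℕ, e = n ∧ 0 < n ∧ twistPow k H T n = convOne k H}

section PartA
open Coalgebra HopfAlgebra WithConv

lemma algHom_conv_inv {k C A B : Type*} [Field k] [AddCommGroup C] [Module k C] [Coalgebra k C]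
    [Ring A] [Algebra k A] [Ring B] [Algebra k B] (φ : A →ₐ[k] B) (j α : C →ₗ[k] A)
    (h : toConv j * toConv α = 1) :
    toConv (φ.toLinearMap ∘ₗ j) * toConv (φ.toLinearMap ∘ₗ α) = 1 := by
  have := LinearMap.algHom_comp_convMul_distrib φ (toConv j) (toConv α)
  rw [h] at this
  apply ofConv_injective
  refine this.symm.trans ?_
  ext; simp

/-- the flipped coproduct of an inverse is a right convolution inverse of the coproduct -/
lemma flip_inv {k C A : Type*} [Field k] [AddCommGroup C] [Module k C] [Coalgebra k C]
    [Ring A] [Algebra k A] (j α : C →ₗ[k] A) (h : toConv j * toConv α = 1) :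
    toConv ((TensorProduct.map j j) ∘ₗ comul) *
      toConv ((TensorProduct.comm k A A).toLinearMap ∘ₗ (TensorProduct.map α α) ∘ₗ comul) = 1 := by
  let inl : A →ₐ[k] A ⊗[k] A := Algebra.TensorProduct.includeLeft
  let inr : A →ₐ[k] A ⊗[k] A := Algebra.TensorProduct.includeRight
  have h1 : toConv ((TensorProduct.map j j) ∘ₗ comul) =
      toConv (inl.toLinearMap ∘ₗ j) * toConv (inr.toLinearMap ∘ₗ j) := by
    apply ofConv_injective
    ext c
    change _ = LinearMap.mul' k (A ⊗[k] A) (TensorProduct.map _ _ (comul c))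
    simp only [LinearMap.comp_apply]
    generalize comul (R := k) c = t
    induction t with
    | zero => simp
    | add a b ha hb => simp only [map_add, ha, hb]
    | tmul a b => simp [inl, inr]
  have h2 : toConv ((TensorProduct.comm k A A).toLinearMap ∘ₗ (TensorProduct.map α α) ∘ₗ comul) =
      toConv (inr.toLinearMap ∘ₗ α) * toConv (inl.toLinearMap ∘ₗ α) := by
    apply ofConv_injective
    ext c
    change _ = LinearMap.mul' k (A ⊗[k] A) (TensorProduct.map _ _ (comul c))
    simp only [LinearMap.comp_apply]
    generalize comul (R := k) c = t
    induction t with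
    | zero => simp
    | add a b ha hb => simp only [map_add, ha, hb]
    | tmul a b => simp [inl, inr]
  rw [h1, h2, mul_assoc, ← mul_assoc (toConv (inr.toLinearMap ∘ₗ j)), algHom_conv_inv inr j α h,
    one_mul, algHom_conv_inv inl j α h]

lemma fitting_aux {k V : Type*} [Field k] [AddCommGroup V] [Module k V] [FiniteDimensional k V]
    (T : Module.End k V) : ∃ (n : ℕ) (q : Module.End k V), n ≠ 0 ∧
      q * T ^ (2 * n) = T ^ (2 * n) * q ∧ q * T ^ (2 * n) * T ^ (2 * n) = T ^ (2 * n) := by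
  have h0 : minpoly k T ≠ 0 := minpoly.ne_zero (Algebra.IsIntegral.isIntegral T)
  obtain ⟨g, hg, hnd⟩ := Polynomial.exists_eq_pow_rootMultiplicity_mul_and_not_dvd _ h0 (0 : k)
  set m := Polynomial.rootMultiplicity 0 (minpoly k T)
  have hco : IsCoprime ((Polynomial.X - Polynomial.C (0 : k)) ^ (2 * (m + 1))) g :=
    IsCoprime.pow_left (((Polynomial.irreducible_X_sub_C (0 : k)).coprime_iff_not_dvd).2 hnd)
  obtain ⟨u, w, huw⟩ := hco
  rw [Polynomial.C_0, sub_zero] at huw hg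
  have hz : T ^ m * Polynomial.aeval T g = 0 := by
    have := minpoly.aeval k T
    rw [hg] at this
    simpa using this
  have hz2 : Polynomial.aeval T g * T ^ (2 * (m + 1)) = 0 := by
    have hc : Commute (Polynomial.aeval T g) (T ^ m) := by
      have := (Polynomial.aeval_X_pow (R := k) T (n := m))
      rw [← this]; exact (Commute.all g (Polynomial.X ^ m)).map (Polynomial.aeval T)
    rw [(by ring : 2 * (m + 1) = m + (m + 2)), pow_add, ← mul_assoc, hc.eq, hz, zero_mul]
  refine ⟨m + 1, Polynomial.aeval T u, m.succ_ne_zero, ?_, ?_⟩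
  · have := (Polynomial.aeval_X_pow (R := k) T (n := 2 * (m + 1)))
    rw [← this]; exact (Commute.all u (Polynomial.X ^ (2 * (m + 1)))).map (Polynomial.aeval T)
  · have h1 := congrArg (Polynomial.aeval T) huw
    simp only [map_add, map_mul, map_pow, Polynomial.aeval_X, map_one] at h1
    have h2 := congrArg (· * T ^ (2 * (m + 1))) h1
    simp only [add_mul, one_mul] at h2
    rw [mul_assoc (Polynomial.aeval T w), hz2, mul_zero, add_zero] at h2
    exact h2

variable {k H A : Type*} [Field k] [Ring H] [HopfAlgebra k H] [Ring A] [Algebra k A]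

lemma descend_aux (φ : H →ₐ[k] A) (p : H →ₗc[k] H)
    (h : φ.toLinearMap ∘ₗ antipode k ∘ₗ p.toLinearMap = φ.toLinearMap ∘ₗ antipode k) :
    φ.toLinearMap ∘ₗ p.toLinearMap = φ.toLinearMap := by
  have e1 : toConv φ.toLinearMap * toConv (φ.toLinearMap ∘ₗ antipode k) = 1 := by
    have := LinearMap.algHom_comp_convMul_distrib φ (toConv (LinearMap.id (R := k) (M := H)))
      (toConv (antipode k))
    rw [LinearMap.id_mul_antipode] at this
    apply ofConv_injective
    simp only [LinearMap.comp_id] at this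
    rw [← this]
    ext; simp
  have e2 : toConv (φ.toLinearMap ∘ₗ antipode k) * toConv φ.toLinearMap = 1 := by
    have := LinearMap.algHom_comp_convMul_distrib φ (toConv (antipode k))
      (toConv (LinearMap.id (R := k) (M := H)))
    rw [LinearMap.antipode_mul_id] at this
    apply ofConv_injective
    simp only [LinearMap.comp_id] at this
    rw [← this]
    ext; simp
  have e3 : toConv (φ.toLinearMap ∘ₗ p.toLinearMap) * toConv (φ.toLinearMap ∘ₗ antipode k) = 1 := by
    have := LinearMap.convMul_comp_coalgHom_distrib (toConv φ.toLinearMap)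
      (toConv (φ.toLinearMap ∘ₗ antipode k)) p
    rw [e1] at this
    apply ofConv_injective
    simp only [LinearMap.comp_assoc, h] at this
    rw [← this]
    ext; simp
  exact toConv_injective (left_inv_eq_right_inv e3 e2)

lemma antipode_pow_hom (i : ℕ) :
    (∃ φ : H →ₐ[k] H, φ.toLinearMap = (antipode k : Module.End k H) ^ i) ∨
    (∃ φ : H →ₐ[k] Hᵐᵒᵖ, φ.toLinearMap =
      (MulOpposite.opLinearEquiv k).toLinearMap ∘ₗ ((antipode k : Module.End k H) ^ i)) := by
  induction i with
  | zero => exact Or.inl ⟨AlgHom.id k H, rfl⟩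
  | succ i ih =>
    rcases ih with ⟨φ, hφ⟩ | ⟨φ, hφ⟩
    · right
      refine ⟨(antipodeAlgHomOp k H).comp φ, ?_⟩
      rw [pow_succ', ← hφ]; rfl
    · left
      refine ⟨(AlgEquiv.opOp k H).symm.toAlgHom.comp ((AlgHom.op (antipodeAlgHomOp k H)).comp φ), ?_⟩
      have : ∀ x, φ x = MulOpposite.op (((antipode k : Module.End k H) ^ i) x) :=
        fun x => LinearMap.congr_fun hφ x
      ext x
      simp [this, pow_succ']

lemma comul_antipode (x : H) : comul (R := k) (antipode k x) =
    TensorProduct.comm k H H (TensorProduct.map (antipode k) (antipode k) (comul x)) := by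
  have h1 := flip_inv (LinearMap.id (R := k) (M := H)) (antipode k) LinearMap.id_mul_antipode
  have h2 : toConv ((Bialgebra.comulAlgHom k H).toLinearMap ∘ₗ antipode k) * toConv ((TensorProduct.map LinearMap.id LinearMap.id) ∘ₗ comul) = 1 := by
    have := LinearMap.algHom_comp_convMul_distrib (Bialgebra.comulAlgHom k H) (toConv (antipode k))
      (toConv (LinearMap.id (R := k) (M := H)))
    rw [LinearMap.antipode_mul_id] at this
    apply ofConv_injective
    simp only [LinearMap.comp_id] at this
    rw [TensorProduct.map_id, LinearMap.id_comp]
    refine this.symm.trans ?_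
    ext; simp
  have h3 := toConv_injective (left_inv_eq_right_inv h2 h1)
  exact LinearMap.congr_fun h3 x

lemma comul_antipode_pow (n : ℕ) (x : H) :
    comul (R := k) (((antipode k : Module.End k H) ^ (2 * n)) x) =
    TensorProduct.map ((antipode k : Module.End k H) ^ (2 * n))
      ((antipode k : Module.End k H) ^ (2 * n)) (comul x) := by
  induction n generalizing x with
  | zero => simp [Module.End.one_eq_id]
  | succ n ih =>
    have : 2 * (n + 1) = 2 * n + 1 + 1 := by ring
    rw [this, pow_succ, pow_succ, Module.End.mul_apply, Module.End.mul_apply, ih,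
      comul_antipode, comul_antipode]
    generalize comul (R := k) x = t
    induction t with
    | zero => simp
    | add a b ha hb => simp only [map_add, ha, hb]
    | tmul a b => simp

theorem antipode_injective [FiniteDimensional k H] :
    Function.Injective (antipode k : H →ₗ[k] H) := by
  obtain ⟨n, q, hn, hc, hq⟩ := fitting_aux (antipode k : Module.End k H)
  set P : Module.End k H := (antipode k : Module.End k H) ^ (2 * n) with hP
  have hPc : ∀ x, comul (R := k) (P x) = TensorProduct.map P P (comul x) := comul_antipode_pow n
  have hPq : P * (q * P) = P := by rw [← mul_assoc, ← hc, hq]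
  have hcounitS : ∀ (i : ℕ) (x : H), counit (R := k) (((antipode k : Module.End k H) ^ i) x) = counit x := by
    intro i
    induction i with
    | zero => intro x; simp
    | succ i ih => intro x; rw [pow_succ, Module.End.mul_apply, ih]; simp
  let p : H →ₗc[k] H :=
    { toLinearMap := q * P
      counit_comp := by
        ext x
        have h1 : counit (R := k) (P ((q * P) x)) = counit (P x) := by
          rw [← Module.End.mul_apply, hPq]
        rw [hcounitS, hcounitS] at h1
        exact h1
      map_comp_comul := by
        have h1 : ∀ x, TensorProduct.map (q * P) (q * P) (comul x) =
            TensorProduct.map q q (comul (R := k) (P x)) := by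
          intro x
          rw [hPc, Module.End.mul_eq_comp, TensorProduct.map_comp]; rfl
        ext x
        have h2 : TensorProduct.map (q * P) (q * P) (comul (R := k) ((q * P) x)) =
          comul (R := k) ((q * P) x) := by
          have h3 : (q * P) x = P (q x) := by rw [hc]; rfl
          rw [h3, hPc, ← LinearMap.comp_apply, ← TensorProduct.map_comp, ← Module.End.mul_eq_comp,
            hq]
        have h4 : TensorProduct.map (q * P) (q * P) (comul (R := k) ((q * P) x)) =
          TensorProduct.map (q * P) (q * P) (comul (R := k) x) := by
          rw [h1, h1, ← Module.End.mul_apply, hPq]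
        rw [LinearMap.comp_apply, LinearMap.comp_apply, ← h4, h2] }
  have hp : p.toLinearMap = q * P := rfl
  have key : ∀ i ≤ 2 * n, ((antipode k : Module.End k H) ^ i) ∘ₗ p.toLinearMap = (antipode k : Module.End k H) ^ i := by
    intro i hi
    induction hi using Nat.decreasingInduction with
    | self => rw [hp]; exact hPq
    | of_succ i hi ih =>
      rcases antipode_pow_hom (k := k) (H := H) i with ⟨φ, hφ⟩ | ⟨φ, hφ⟩
      · have := descend_aux φ p (by
          rw [← LinearMap.comp_assoc, hφ]
          rw [pow_succ] at ih
          exact ih)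
        rwa [hφ] at this
      · have := descend_aux φ p (by
          rw [← LinearMap.comp_assoc, hφ]
          rw [pow_succ] at ih
          exact congrArg (fun f => (MulOpposite.opLinearEquiv k).toLinearMap ∘ₗ f) ih)
        rw [hφ, LinearMap.comp_assoc] at this
        ext x
        exact (MulOpposite.opLinearEquiv k).injective (LinearMap.congr_fun this x)
  have h0 := key 0 (Nat.zero_le _)
  rw [pow_zero, hp] at h0
  have h0' : q * P = 1 := h0
  have hPinj : Function.Injective P := by
    intro a b hab
    have : (q * P) a = (q * P) b := by simp [hab]
    simpa [h0'] using this
  obtain ⟨m, hm⟩ : ∃ m, 2 * n = m + 1 := ⟨2 * n - 1, by omega⟩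
  intro a b hab
  apply hPinj
  rw [hP, hm, pow_succ, Module.End.mul_apply, Module.End.mul_apply, hab]

end PartA
section PartB
open Coalgebra HopfAlgebra WithConv

variable {k H : Type*} [Field k] [Ring H] [HopfAlgebra k H]

/-- The map `b ⊗ v ↦ flip (D b) * (1 ⊗ v)`. -/
def tauD {k H : Type*} [Field k] [Ring H] [Algebra k H] (D : H →ₗ[k] H ⊗[k] H) :
    Module.End k (H ⊗[k] H) :=
  LinearMap.mul' k (H ⊗[k] H) ∘ₗ TensorProduct.map ((TensorProduct.comm k H H).toLinearMap ∘ₗ D)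
    (Algebra.TensorProduct.includeRight : H →ₐ[k] H ⊗[k] H).toLinearMap

lemma tauD_tmul {k H : Type*} [Field k] [Ring H] [Algebra k H] (D : H →ₗ[k] H ⊗[k] H) (b v : H) :
    tauD D (b ⊗ₜ v) = TensorProduct.comm k H H (D b) * (1 ⊗ₜ v) := by
  simp [tauD]

/-- The identity viewed as a map to the opposite algebra. -/
def iotaOp (k H : Type*) [Field k] [Ring H] [HopfAlgebra k H] : WithConv (H →ₗ[k] Hᵐᵒᵖ) :=
  toConv (MulOpposite.opLinearEquiv k).toLinearMap

/-- `b ⊗ v ↦ b₂ ⊗ f(b₁) v`. -/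
def Th (f : WithConv (H →ₗ[k] Hᵐᵒᵖ)) : Module.End k (H ⊗[k] H) :=
  tauD (TensorProduct.map ((MulOpposite.opLinearEquiv k).symm.toLinearMap ∘ₗ f.ofConv)
    LinearMap.id ∘ₗ comul)

lemma Th_one : Th (1 : WithConv (H →ₗ[k] Hᵐᵒᵖ)) = 1 := by
  ext b v
  simp only [TensorProduct.AlgebraTensorModule.curry_apply, TensorProduct.curry_apply,
    LinearMap.restrictScalars_apply, Th, tauD_tmul, LinearMap.comp_apply, Module.End.one_apply]
  have : ∀ t : H ⊗[k] H, TensorProduct.map ((MulOpposite.opLinearEquiv k).symm.toLinearMap ∘ₗ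
      (1 : WithConv (H →ₗ[k] Hᵐᵒᵖ)).ofConv) LinearMap.id t =
      TensorProduct.map (Algebra.linearMap k H) LinearMap.id (counit.rTensor H t) := by
    intro t
    induction t with
    | zero => simp
    | add a b ha hb => simp only [map_add, ha, hb]
    | tmul a b => simp [LinearMap.convOne_def]
  rw [this, rTensor_counit_comul]
  simp

lemma Th_iota : Th (iotaOp k H) = tauD comul := by
  have : (MulOpposite.opLinearEquiv k).symm.toLinearMap ∘ₗ (iotaOp k H).ofConv = LinearMap.id := by
    ext x; simp [iotaOp]
  rw [Th, this, TensorProduct.map_id, LinearMap.id_comp]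

lemma Th_mul_iota (f : WithConv (H →ₗ[k] Hᵐᵒᵖ)) :
    tauD comul * Th f = Th (f * iotaOp k H) := by
  ext b v
  simp only [TensorProduct.AlgebraTensorModule.curry_apply, TensorProduct.curry_apply,
    LinearMap.restrictScalars_apply, Th, tauD_tmul, LinearMap.comp_apply, Module.End.mul_apply]
  let g : H →ₗ[k] H := (MulOpposite.opLinearEquiv k).symm.toLinearMap ∘ₗ f.ofConv
  let X : H ⊗[k] (H ⊗[k] H) →ₗ[k] H ⊗[k] H :=
    LinearMap.mulRight k (1 ⊗ₜ[k] v) ∘ₗ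
    LinearMap.mul' k (H ⊗[k] H) ∘ₗ (TensorProduct.comm k _ _).toLinearMap ∘ₗ TensorProduct.map
     ((Algebra.TensorProduct.includeRight : H →ₐ[k] H ⊗[k] H).toLinearMap ∘ₗ g)
     (TensorProduct.comm k H H).toLinearMap
  have h1 : ∀ t : H ⊗[k] H, tauD comul (TensorProduct.comm k H H (TensorProduct.map g LinearMap.id t)
      * (1 ⊗ₜ v)) = X (comul.lTensor H t) := by
    intro t
    induction t with
    | zero => simp
    | add a b ha hb => simp only [map_add, ha, hb, add_mul]
    | tmul a b => simp [X, tauD_tmul, mul_assoc]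
  have h2 : ∀ t : H ⊗[k] H, TensorProduct.comm k H H (TensorProduct.map
      ((MulOpposite.opLinearEquiv k).symm.toLinearMap ∘ₗ (f * iotaOp k H).ofConv) LinearMap.id t)
      * (1 ⊗ₜ v) = X (TensorProduct.assoc k H H H (comul.rTensor H t)) := by
    intro t
    induction t with
    | zero => simp
    | add a b ha hb => simp only [map_add, ha, hb, add_mul]
    | tmul a b =>
      simp only [LinearMap.convMul_def, TensorProduct.map_tmul, LinearMap.comp_apply,
        LinearMap.rTensor_tmul]
      generalize comul (R := k) a = s
      induction s with
      | zero => simp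
      | add a b ha hb => simp only [map_add, TensorProduct.tmul_add, TensorProduct.add_tmul, ha, hb, add_mul]
      | tmul a b => simp [X, g, iotaOp]
  rw [h1, h2, coassoc_apply]

lemma tau_pow (n : ℕ) : (tauD (comul : H →ₗ[k] H ⊗[k] H)) ^ n = Th (iotaOp k H ^ n) := by
  induction n with
  | zero => rw [pow_zero, pow_zero, Th_one]
  | succ n ih => rw [pow_succ', ih, Th_mul_iota, pow_succ]

lemma Th_eq_one {f : WithConv (H →ₗ[k] Hᵐᵒᵖ)} (h : Th f = 1) : f = 1 := by
  apply ofConv_injective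
  ext b
  have h1 := congrArg (fun g : Module.End k (H ⊗[k] H) =>
    TensorProduct.lid k H (counit.rTensor H (g (b ⊗ₜ 1)))) h
  simp only [Th, tauD_tmul, LinearMap.comp_apply, Module.End.one_apply] at h1
  have h2 : ∀ t : H ⊗[k] H, TensorProduct.lid k H (counit.rTensor H (TensorProduct.comm k H H
     (TensorProduct.map ((MulOpposite.opLinearEquiv k).symm.toLinearMap ∘ₗ f.ofConv)
      LinearMap.id t) * (1 ⊗ₜ 1))) = TensorProduct.rid k H
      (TensorProduct.map ((MulOpposite.opLinearEquiv k).symm.toLinearMap ∘ₗ f.ofConv)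
      LinearMap.id (counit.lTensor H t)) := by
    intro t
    induction t with
    | zero => simp
    | add a b ha hb => simp only [map_add, ha, hb, add_mul]
    | tmul a b => simp
  rw [h2, lTensor_counit_comul] at h1
  simp only [TensorProduct.map_tmul, LinearMap.comp_apply, LinearMap.id_apply,
    TensorProduct.rid_tmul, LinearMap.rTensor_tmul, TensorProduct.lid_tmul, one_smul] at h1
  apply (MulOpposite.opLinearEquiv k).symm.injective
  refine h1.trans ?_
  simp [LinearMap.convOne_def, Algebra.algebraMap_eq_smul_one]

lemma sweedlerPow_eq (n : ℕ) : toConv (sweedlerPow k H n) = (toConv LinearMap.id) ^ n := by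
  unfold sweedlerPow
  induction n with
  | zero => rfl
  | succ n ih => rw [pow_succ', ← ih]; rfl

lemma sweedler_iff_tau [FiniteDimensional k H] (n : ℕ) :
    sweedlerPow k H n = convOne k H ↔ (tauD (comul : H →ₗ[k] H ⊗[k] H)) ^ n = 1 := by
  have a1 : sweedlerPow k H n = convOne k H ↔
      (toConv (LinearMap.id : H →ₗ[k] H)) ^ n = 1 := by
    rw [← sweedlerPow_eq]
    exact toConv_injective.eq_iff.symm
  have hcomm : Commute (toConv (LinearMap.id : H →ₗ[k] H)) (toConv (antipode k)) := by
    rw [Commute, SemiconjBy, LinearMap.id_mul_antipode, LinearMap.antipode_mul_id]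
  have hmul : (toConv (LinearMap.id : H →ₗ[k] H)) ^ n * (toConv (antipode k)) ^ n = 1 := by
    rw [← hcomm.mul_pow, LinearMap.id_mul_antipode, one_pow]
  have a2 : (toConv (LinearMap.id : H →ₗ[k] H)) ^ n = 1 ↔
      (toConv (antipode k : H →ₗ[k] H)) ^ n = 1 := by
    constructor
    · intro h; rwa [h, one_mul] at hmul
    · intro h; rwa [h, mul_one] at hmul
  let s : Hᵐᵒᵖ →ₐ[k] H :=
    (AlgEquiv.opOp k H).symm.toAlgHom.comp (AlgHom.op (antipodeAlgHomOp k H))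
  have hs : ∀ x, s x = antipode k (MulOpposite.unop x) := by
    intro x; simp [s]
  have hsinj : Function.Injective s := by
    intro x y hxy
    rw [hs, hs] at hxy
    exact MulOpposite.unop_injective (antipode_injective hxy)
  have hsp : ∀ m : ℕ, toConv (s.toLinearMap ∘ₗ (iotaOp k H ^ m).ofConv) =
      (toConv (antipode k : H →ₗ[k] H)) ^ m := by
    intro m
    induction m with
    | zero => 
      rw [pow_zero, pow_zero]
      apply ofConv_injective
      ext x
      simp [LinearMap.convOne_def]
      exact s.commutes _
    | succ m ih =>
      rw [pow_succ, pow_succ, LinearMap.algHom_comp_convMul_distrib, toConv_ofConv, ih]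
      congr 1
  have a3 : (toConv (antipode k : H →ₗ[k] H)) ^ n = 1 ↔ iotaOp k H ^ n = 1 := by
    have h0 := hsp 0
    rw [pow_zero, pow_zero] at h0
    rw [← hsp, ← h0, toConv_injective.eq_iff]
    constructor
    · intro h
      apply ofConv_injective
      ext x
      exact hsinj (LinearMap.congr_fun h x)
    · intro h; rw [h]
  rw [a1, a2, a3, tau_pow]
  constructor
  · intro h; rw [h, Th_one]
  · exact Th_eq_one

end PartB
section PartC
open Coalgebra HopfAlgebra WithConv

/-- `t₁ ⊗ t₂ ↦ S(t₁) y t₂`. -/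
def Nmap (k : Type*) {H : Type*} [Field k] [Ring H] [HopfAlgebra k H] (y : H) :
    H ⊗[k] H →ₗ[k] H :=
  LinearMap.mul' k H ∘ₗ TensorProduct.map (LinearMap.mulRight k y ∘ₗ antipode k) LinearMap.id

lemma Nmap_tmul {k H : Type*} [Field k] [Ring H] [HopfAlgebra k H] (y a b : H) :
    Nmap k y (a ⊗ₜ b) = antipode k a * y * b := by
  simp [Nmap]

lemma Nmap_mul {k H : Type*} [Field k] [Ring H] [HopfAlgebra k H] (y : H) (s t : H ⊗[k] H) :
    Nmap k y (s * t) = Nmap k (Nmap k y s) t := by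
  have h0 : ∀ y z : H, Nmap k (y + z) = Nmap k y + Nmap k z := by
    intro y z; ext a b; simp [Nmap_tmul, mul_add, add_mul]
  have h00 : Nmap k (0 : H) = 0 := by
    ext a b; simp [Nmap_tmul]
  induction s with
  | zero => simp [h00]
  | add a b ha hb => simp only [add_mul, map_add, ha, hb, h0, LinearMap.add_apply]
  | tmul a b =>
    induction t with
    | zero => simp
    | add a b ha hb => simp only [mul_add, map_add, ha, hb]
    | tmul c d => simp [Nmap_tmul, antipode_mul_antidistrib, mul_assoc]

/-- The convolution inverse of the identification. -/
def alphaMap {k H C : Type*} [Field k] [Ring H] [HopfAlgebra k H] [AddCommGroup C] [Module k C]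
    (j : C →ₗ[k] H) (J' : H ⊗[k] H) : C →ₗ[k] H :=
  (LinearMap.mulRight k (Nmap k 1 J') ∘ₗ antipode k) ∘ₗ j

section
variable {k H C : Type*} [Field k] [Ring H] [HopfAlgebra k H] [AddCommGroup C] [Module k C]
  [Coalgebra k C] (J J' : H ⊗[k] H) (j : C →ₗ[k] H)

lemma alpha_left (hJ'J : J' * J = 1)
    (hδ : ∀ c, TensorProduct.map j j (comul c) = J * comul (j c))
    (hε : ∀ c, counit (R := k) c = counit (R := k) (j c)) :
    toConv (alphaMap j J') * toConv j = 1 := by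
  apply ofConv_injective
  ext c
  change LinearMap.mul' k H (TensorProduct.map (alphaMap j J') j (comul c)) =
    algebraMap k H (counit c)
  have h1 : ∀ t, LinearMap.mul' k H (TensorProduct.map (alphaMap j J') j t) =
      Nmap k (Nmap k 1 J') (TensorProduct.map j j t) := by
    intro t
    induction t with
    | zero => simp
    | add a b ha hb => simp only [map_add, ha, hb]
    | tmul a b => simp [alphaMap, Nmap_tmul]
  rw [h1, hδ, Nmap_mul, ← Nmap_mul 1 J' J, hJ'J, hε]
  have h2 : Nmap k (1 : H) 1 = 1 := by
    rw [Algebra.TensorProduct.one_def, Nmap_tmul]; simp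
  rw [h2]
  have h3 : ∀ t, Nmap k (1 : H) t = LinearMap.mul' k H ((antipode k).rTensor H t) := by
    intro t
    induction t with
    | zero => simp
    | add a b ha hb => simp only [map_add, ha, hb]
    | tmul a b => simp [Nmap_tmul]
  rw [h3]
  simp

lemma conv_comm {k H C : Type*} [Field k] [Ring H] [Algebra k H] [AddCommGroup C] [Module k C]
    [Coalgebra k C]
    [FiniteDimensional k H] [FiniteDimensional k C] {a b : C →ₗ[k] H}
    (h : toConv a * toConv b = 1) : toConv b * toConv a = 1 := by
  have : FiniteDimensional k (WithConv (C →ₗ[k] H)) :=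
    Module.Finite.equiv (WithConv.linearEquiv k (C →ₗ[k] H)).symm
  have : IsArtinianRing (WithConv (C →ₗ[k] H)) := IsArtinianRing.of_finite k _
  exact mul_eq_one_comm.1 h

lemma alpha_comul (hJ'J : J' * J = 1)
    (hδ : ∀ c, TensorProduct.map j j (comul c) = J * comul (j c))
    {α : C →ₗ[k] H} (h1 : toConv α * toConv j = 1) (h2 : toConv j * toConv α = 1) (c : C) :
    comul (α c) * J' = TensorProduct.comm k H H (TensorProduct.map α α (comul c)) := by
  have hr := flip_inv j α h2
  have hl : toConv (LinearMap.mulRight k J' ∘ₗ comul ∘ₗ α) *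
      toConv ((TensorProduct.map j j) ∘ₗ comul) = 1 := by
    rw [← algHom_conv_inv (Bialgebra.comulAlgHom k H) α j h1]
    apply ofConv_injective
    ext c
    change LinearMap.mul' k _ (TensorProduct.map _ _ (comul c)) =
      LinearMap.mul' k _ (TensorProduct.map _ _ (comul c))
    generalize comul (R := k) c = t
    induction t with
    | zero => simp
    | add a b ha hb => simp only [map_add, ha, hb]
    | tmul a b =>
      simp [hδ]
      rw [mul_assoc, ← mul_assoc J', hJ'J, one_mul]
  have := left_inv_eq_right_inv hl hr
  exact LinearMap.congr_fun (congrArg ofConv this) c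

end

/-- `p ⊗ (q ⊗ r) ↦ (b ⊗ v ↦ (j r) b α(p) ⊗ (j q) v)`. -/
def Gop {k H C : Type*} [Field k] [Ring H] [Algebra k H] [AddCommGroup C] [Module k C]
    (α j : C →ₗ[k] H) : C ⊗[k] (C ⊗[k] C) →ₗ[k] Module.End k (H ⊗[k] H) :=
  LinearMap.mul' k (Module.End k (H ⊗[k] H)) ∘ₗ TensorProduct.map
    (LinearMap.rTensorHom H ∘ₗ (LinearMap.mul k H).flip ∘ₗ α)
    (LinearMap.mul' k (Module.End k (H ⊗[k] H)) ∘ₗ TensorProduct.map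
      (LinearMap.lTensorHom H ∘ₗ LinearMap.mul k H ∘ₗ j)
      (LinearMap.rTensorHom H ∘ₗ LinearMap.mul k H ∘ₗ j))

lemma Gop_tmul {k H C : Type*} [Field k] [Ring H] [Algebra k H] [AddCommGroup C] [Module k C]
    (α j : C →ₗ[k] H) (p q r : C) (b v : H) :
    Gop α j (p ⊗ₜ (q ⊗ₜ r)) (b ⊗ₜ v) = (j r * b * α p) ⊗ₜ (j q * v) := by
  simp [Gop]

lemma Gop_S_mul {k H : Type*} [Field k] [Ring H] [HopfAlgebra k H] (s t : H ⊗[k] (H ⊗[k] H)) :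
    Gop (antipode k) LinearMap.id (s * t) =
      Gop (antipode k) LinearMap.id s * Gop (antipode k) LinearMap.id t := by
  have key : LinearMap.compr₂ (LinearMap.mul k (H ⊗[k] (H ⊗[k] H)))
        (Gop (antipode k) LinearMap.id) =
      (LinearMap.mul k (Module.End k (H ⊗[k] H))).compl₁₂ (Gop (antipode k) LinearMap.id)
        (Gop (antipode k) LinearMap.id) := by
    ext a b c a' b' c' x y
    simp [Gop_tmul, antipode_mul_antidistrib, mul_assoc]
  exact LinearMap.congr_fun (LinearMap.congr_fun key s) t

lemma Gop_S_one {k H : Type*} [Field k] [Ring H] [HopfAlgebra k H] :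
    Gop (antipode k) LinearMap.id (1 : H ⊗[k] (H ⊗[k] H)) = 1 := by
  ext x y
  simp [Algebra.TensorProduct.one_def, Gop_tmul]

/-- coalgebra bookkeeping -/
lemma coalg_collapse {k C M : Type*} [Field k] [AddCommGroup C] [Module k C] [Coalgebra k C]
    [AddCommGroup M] [Module k M]
    (F : C ⊗[k] (C ⊗[k] (C ⊗[k] (C ⊗[k] C))) →ₗ[k] M) (F' : C ⊗[k] (C ⊗[k] C) →ₗ[k] M)
    (hF : ∀ (p s : C) (w : C ⊗[k] C), F (p ⊗ₜ TensorProduct.assoc k C C (C ⊗[k] C)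
      (comul s ⊗ₜ w)) = counit (R := k) s • F' (p ⊗ₜ w)) (c : C) :
    F (TensorProduct.assoc k C C (C ⊗[k] (C ⊗[k] C))
      (TensorProduct.map comul (comul.lTensor C) (comul.lTensor C (comul c)))) =
      F' (comul.lTensor C (comul c)) := by
  let δ3 : C →ₗ[k] C ⊗[k] (C ⊗[k] C) := comul.lTensor C ∘ₗ comul
  have e1 : ∀ t : C ⊗[k] C, TensorProduct.assoc k C C (C ⊗[k] (C ⊗[k] C))
      (TensorProduct.map comul (comul.lTensor C) (comul.lTensor C t)) =
      (δ3.lTensor C).lTensor C (TensorProduct.assoc k C C C (comul.rTensor C t)) := by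
    intro t
    induction t with
    | zero => simp
    | add a b ha hb => simp only [map_add, ha, hb]
    | tmul a b =>
      simp only [LinearMap.lTensor_tmul, LinearMap.rTensor_tmul, TensorProduct.map_tmul]
      generalize comul (R := k) a = u
      induction u with
      | zero => simp
      | add a b ha hb => simp only [map_add, TensorProduct.add_tmul, ha, hb]
      | tmul a b => simp [δ3]
  have e2 : ∀ u : C ⊗[k] C, δ3.lTensor C u = (comul.lTensor C).lTensor C (comul.lTensor C u) := by
    intro u
    induction u with
    | zero => simp
    | add a b ha hb => simp only [map_add, ha, hb]
    | tmul a b => simp [δ3]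
  have e3 : ∀ u : C ⊗[k] C, (comul.lTensor C).lTensor C
      (TensorProduct.assoc k C C C (comul.rTensor C u)) =
      TensorProduct.assoc k C C (C ⊗[k] C) (TensorProduct.map comul comul u) := by
    intro u
    induction u with
    | zero => simp
    | add a b ha hb => simp only [map_add, ha, hb]
    | tmul a b =>
      simp only [LinearMap.rTensor_tmul, TensorProduct.map_tmul]
      generalize comul (R := k) a = u
      induction u with
      | zero => simp
      | add a b ha hb => simp only [map_add, TensorProduct.add_tmul, ha, hb]
      | tmul a b => simp
  have e4 : ∀ (p : C) (u : C ⊗[k] C), F (p ⊗ₜ TensorProduct.assoc k C C (C ⊗[k] C)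
      (TensorProduct.map comul comul u)) =
      F' (p ⊗ₜ (comul (TensorProduct.lid k C (counit.rTensor C u)))) := by
    intro p u
    induction u with
    | zero => simp
    | add a b ha hb => simp only [map_add, TensorProduct.tmul_add, ha, hb]
    | tmul a b => simp [hF]
  rw [e1, coassoc_apply]
  generalize comul (R := k) c = t
  induction t with
  | zero => simp
  | add a b ha hb => simp only [map_add, ha, hb]
  | tmul p d =>
    rw [LinearMap.lTensor_tmul, LinearMap.lTensor_tmul, e2, ← coassoc_apply, e3, e4,
      rTensor_counit_comul]
    simp
end PartC
section PartC2
open Coalgebra HopfAlgebra WithConv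

/-- the twisted comultiplication -/
def twComul {k H : Type*} [Field k] [Ring H] [HopfAlgebra k H] (J J' : H ⊗[k] H) :
    H →ₗ[k] H ⊗[k] H :=
  LinearMap.mulRight k J' ∘ₗ LinearMap.mulLeft k J ∘ₗ comul

variable {k H C : Type*} [Field k] [Ring H] [HopfAlgebra k H] [AddCommGroup C] [Module k C]
  [Coalgebra k C] (J J' : H ⊗[k] H) (j : C →ₗ[k] H)

lemma comm_mul' (x y : H ⊗[k] H) : TensorProduct.comm k H H (x * y) =
    TensorProduct.comm k H H x * TensorProduct.comm k H H y :=
  map_mul (Algebra.TensorProduct.comm k H H) x y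

lemma intertwine (c : C)
    (hδ : ∀ c, TensorProduct.map j j (comul c) = J * comul (j c))
    {α : C →ₗ[k] H} (h1 : toConv α * toConv j = 1)
    (h3 : ∀ c, comul (α c) * J' = TensorProduct.comm k H H (TensorProduct.map α α (comul c))) :
    tauD (twComul J J') * Gop α j (comul.lTensor C (comul c)) =
      Gop α j (comul.lTensor C (comul c)) * tauD comul := by
  let inl : H →ₐ[k] H ⊗[k] H := Algebra.TensorProduct.includeLeft
  let inr : H →ₐ[k] H ⊗[k] H := Algebra.TensorProduct.includeRight
  let E1 : C →ₗ[k] Module.End k (H ⊗[k] H) :=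
    (LinearMap.mul k (H ⊗[k] H)).flip ∘ₗ inr.toLinearMap ∘ₗ α
  let E2 : C →ₗ[k] Module.End k (H ⊗[k] H) :=
    (LinearMap.mul k (H ⊗[k] H)).flip ∘ₗ inl.toLinearMap ∘ₗ α
  let E3 : C →ₗ[k] Module.End k (H ⊗[k] H) :=
    (LinearMap.mul k (H ⊗[k] H)).flip ∘ₗ inl.toLinearMap ∘ₗ j
  let E4 : C ⊗[k] C →ₗ[k] Module.End k (H ⊗[k] H) :=
    LinearMap.mul k (H ⊗[k] H) ∘ₗ TensorProduct.map j j
  let m := LinearMap.mul' k (Module.End k (H ⊗[k] H))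
  let F := m ∘ₗ TensorProduct.map E1 ((m ∘ₗ (TensorProduct.comm k _ _).toLinearMap) ∘ₗ
    TensorProduct.map E2 (m ∘ₗ TensorProduct.map E3 E4))
  let F' := m ∘ₗ TensorProduct.map E1 E4
  have hFt : ∀ p1 p2 q w y, F (p1 ⊗ₜ (p2 ⊗ₜ (q ⊗ₜ w))) y =
      (TensorProduct.map j j w * y) * ((α p2 * j q) ⊗ₜ α p1) := by
    intro p1 p2 q w y
    simp [F, m, E1, E2, E3, E4, inl, inr, mul_assoc]
  have hFt' : ∀ p w y, F' (p ⊗ₜ w) y =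
      (TensorProduct.map j j w * y) * (1 ⊗ₜ α p) := by
    intro p w y
    simp [F', m, E1, E4, inr, mul_assoc]
  have hcol := coalg_collapse F F' (by
    intro p s w
    have hs : LinearMap.mul' k H (TensorProduct.map α j (comul s)) =
        algebraMap k H (counit s) := LinearMap.congr_fun (congrArg ofConv h1) s
    have hg : ∀ t : C ⊗[k] C, ∀ y, F (p ⊗ₜ TensorProduct.assoc k C C (C ⊗[k] C) (t ⊗ₜ w)) y =
        (TensorProduct.map j j w * y) *
          ((LinearMap.mul' k H (TensorProduct.map α j t)) ⊗ₜ α p) := by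
      intro t y
      induction t with
      | zero => simp
      | add a b ha hb => simp only [map_add, TensorProduct.add_tmul, TensorProduct.tmul_add, ha, hb,
          LinearMap.add_apply, mul_add]
      | tmul a b =>
        rw [TensorProduct.assoc_tmul, hFt]
        simp
    refine LinearMap.ext fun y => ?_
    rw [hg, hs, LinearMap.smul_apply, hFt', Algebra.algebraMap_eq_smul_one,
      ← TensorProduct.smul_tmul', mul_smul_comm]) c
  refine TensorProduct.ext' fun b v => ?_
  have hL : ∀ t : C ⊗[k] (C ⊗[k] C), tauD (twComul J J') (Gop α j t (b ⊗ₜ v)) =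
      TensorProduct.comm k H H (F (TensorProduct.assoc k C C (C ⊗[k] (C ⊗[k] C))
      (TensorProduct.map comul (comul.lTensor C) t)) (comul b)) * (1 ⊗ₜ v) := by
    intro t
    induction t with
    | zero => simp
    | add a b ha hb => simp only [map_add, LinearMap.add_apply, ha, hb, add_mul]
    | tmul p w =>
      induction w with
      | zero => simp
      | add a b ha hb =>
        simp only [map_add, TensorProduct.tmul_add, LinearMap.add_apply, ha, hb, add_mul]
      | tmul q r =>
        rw [Gop_tmul, tauD_tmul]
        have : twComul J J' (j r * b * α p) = TensorProduct.map j j (comul r) * comul b *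
            TensorProduct.comm k H H (TensorProduct.map α α (comul p)) := by
          rw [hδ, ← h3]
          simp [twComul, mul_assoc]
        rw [this, TensorProduct.map_tmul, LinearMap.lTensor_tmul]
        generalize comul (R := k) p = u
        induction u with
        | zero => simp
        | add a b ha hb =>
          simp only [map_add, TensorProduct.add_tmul, LinearMap.add_apply, ha, hb, add_mul, mul_add]
        | tmul p1 p2 =>
          rw [TensorProduct.assoc_tmul, hFt]
          simp [comm_mul', mul_assoc]
  have hR : ∀ t : C ⊗[k] (C ⊗[k] C), Gop α j t (tauD comul (b ⊗ₜ v)) =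
      TensorProduct.comm k H H (F' t (comul b)) * (1 ⊗ₜ v) := by
    intro t
    rw [tauD_tmul]
    induction t with
    | zero => simp
    | add a b ha hb => simp only [map_add, LinearMap.add_apply, ha, hb, add_mul]
    | tmul p w =>
      induction w with
      | zero => simp
      | add a b ha hb =>
        simp only [map_add, TensorProduct.tmul_add, LinearMap.add_apply, ha, hb, add_mul]
      | tmul q r =>
        rw [hFt']
        generalize comul (R := k) b = u
        induction u with
        | zero => simp
        | add a b ha hb =>
          simp only [map_add, ha, hb, add_mul, mul_add]
        | tmul b1 b2 =>
          simp [Gop_tmul, mul_assoc]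
  rw [Module.End.mul_apply, Module.End.mul_apply, hL, hR, hcol]

lemma Psi_unit [FiniteDimensional k H] (hJJ' : J * J' = 1)
    (c0 : C) (hc0 : j c0 = 1)
    (hδ : ∀ c, TensorProduct.map j j (comul c) = J * comul (j c))
    (hε : ∀ c, counit (R := k) c = counit (R := k) (j c))
    (h2 : toConv j * toConv (alphaMap j J') = 1) :
    IsUnit (Gop (alphaMap j J') j (comul.lTensor C (comul c0))) := by
  set Qt : H := Nmap k 1 J' with hQt
  have hJc : TensorProduct.map j j (comul c0) = J := by rw [hδ, hc0]; simp
  have hQ : ∃ Q : H, Q * Qt = 1 := by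
    refine ⟨LinearMap.mul' k H (TensorProduct.map LinearMap.id (antipode k) J), ?_⟩
    have h := LinearMap.congr_fun (congrArg ofConv h2) c0
    change LinearMap.mul' k H (TensorProduct.map j (alphaMap j J') (comul c0)) =
      algebraMap k H (counit c0) at h
    rw [hε, hc0] at h
    simp only [Bialgebra.counit_one, map_one] at h
    rw [← h, ← hJc]
    generalize comul (R := k) c0 = t
    induction t with
    | zero => simp
    | add a b ha hb => simp only [map_add, ha, hb, add_mul]
    | tmul a b => simp [alphaMap, mul_assoc, Qt]
  obtain ⟨Q, hQ⟩ := hQ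
  have : IsArtinianRing H := IsArtinianRing.of_finite k _
  have hQ' : Qt * Q = 1 := mul_eq_one_comm.1 hQ
  have u1 : IsUnit ((LinearMap.mulRight k Qt).rTensor H : Module.End k (H ⊗[k] H)) := by
    refine ⟨⟨(LinearMap.mulRight k Qt).rTensor H, (LinearMap.mulRight k Q).rTensor H, ?_, ?_⟩, rfl⟩
    · ext x y; simp [mul_assoc, hQ]
    · ext x y; simp [mul_assoc, hQ']
  let DD : H ⊗[k] H →ₐ[k] H ⊗[k] (H ⊗[k] H) :=
    Algebra.TensorProduct.map (AlgHom.id k H) (Bialgebra.comulAlgHom k H)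
  let II : H ⊗[k] H →ₐ[k] H ⊗[k] (H ⊗[k] H) := Algebra.TensorProduct.includeRight
  let K := II J * DD J
  let K' := DD J' * II J'
  have hKK : K * K' = 1 := by
    simp only [K, K']
    rw [mul_assoc, ← mul_assoc (DD J), ← map_mul, hJJ', map_one, one_mul, ← map_mul, hJJ', map_one]
  have u2 : IsUnit (Gop (antipode k) LinearMap.id K) := by
    have h := Gop_S_mul K K'
    rw [hKK, Gop_S_one] at h
    have : IsArtinianRing (Module.End k (H ⊗[k] H)) := IsArtinianRing.of_finite k _
    exact ⟨⟨_, _, h.symm, mul_eq_one_comm.1 h.symm⟩, rfl⟩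
  have hK : TensorProduct.map j (TensorProduct.map j j) (comul.lTensor C (comul c0)) = K := by
    have : ∀ t, TensorProduct.map j (TensorProduct.map j j) (comul.lTensor C t) =
        II J * DD (TensorProduct.map j j t) := by
      intro t
      induction t with
      | zero => simp
      | add a b ha hb => simp only [map_add, ha, hb, mul_add]
      | tmul a b => simp [II, DD, hδ]
    rw [this, hJc]
  have hG : ∀ t, Gop (alphaMap j J') j t = (LinearMap.mulRight k Qt).rTensor H *
      Gop (antipode k) LinearMap.id (TensorProduct.map j (TensorProduct.map j j) t) := by
    intro t
    induction t with
    | zero => simp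
    | add a b ha hb => simp only [map_add, ha, hb, mul_add]
    | tmul p w =>
      induction w with
      | zero => simp
      | add a b ha hb => simp only [map_add, TensorProduct.tmul_add, ha, hb, mul_add]
      | tmul q r =>
        ext x y
        simp [Gop_tmul, alphaMap, Qt, mul_assoc]
  rw [hG, hK]
  exact u1.mul u2

lemma core_iff [FiniteDimensional k H] [FiniteDimensional k C] (hJJ' : J * J' = 1)
    (hJ'J : J' * J = 1) (c0 : C) (hc0 : j c0 = 1)
    (hδ : ∀ c, TensorProduct.map j j (comul c) = J * comul (j c))
    (hε : ∀ c, counit (R := k) c = counit (R := k) (j c)) (n : ℕ) :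
    (tauD (twComul J J')) ^ n = 1 ↔ (tauD (comul : H →ₗ[k] H ⊗[k] H)) ^ n = 1 := by
  have h1 := alpha_left J J' j hJ'J hδ hε
  have h2 := conv_comm h1
  have h3 := alpha_comul J J' j hJ'J hδ h1 h2
  have h4 := intertwine J J' j c0 hδ h1 h3
  obtain ⟨u, hu⟩ := Psi_unit J J' j hJJ' c0 hc0 hδ hε h2
  rw [← hu] at h4
  have h5 : SemiconjBy (u : Module.End k (H ⊗[k] H)) (tauD comul) (tauD (twComul J J')) := h4.symm
  have h6 := h5.pow_right n
  constructor
  · intro h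
    rw [h, SemiconjBy, one_mul] at h6
    exact u.isUnit.mul_left_cancel (by rw [h6, mul_one])
  · intro h
    rw [h, SemiconjBy, mul_one] at h6
    exact u.isUnit.mul_right_cancel (by rw [← h6, one_mul])

end PartC2
section PartD
open Coalgebra HopfAlgebra

/-- copy of `H` carrying the one-sided twisted coalgebra structure -/
def TwC (H : Type*) : Type _ := H

instance {H : Type*} [Ring H] : AddCommGroup (TwC H) := inferInstanceAs (AddCommGroup H)

instance {k H : Type*} [Field k] [Ring H] [Algebra k H] : Module k (TwC H) :=
  inferInstanceAs (Module k H)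

lemma twc_coassoc {k H : Type*} [Field k] [Ring H] [HopfAlgebra k H] (J : H ⊗[k] H)
    (hcoc : TensorProduct.assoc k H H H
        ((J ⊗ₜ[k] (1 : H)) * (TensorProduct.map (Coalgebra.comul (R := k)) LinearMap.id J)) =
      ((1 : H) ⊗ₜ[k] J) * (TensorProduct.map LinearMap.id (Coalgebra.comul (R := k)) J)) :
    (TensorProduct.assoc k H H H).toLinearMap ∘ₗ
      (LinearMap.mulLeft k J ∘ₗ comul).rTensor H ∘ₗ (LinearMap.mulLeft k J ∘ₗ comul) =
      (LinearMap.mulLeft k J ∘ₗ comul).lTensor H ∘ₗ (LinearMap.mulLeft k J ∘ₗ comul) := by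
  let D1 : H ⊗[k] H →ₐ[k] (H ⊗[k] H) ⊗[k] H :=
    Algebra.TensorProduct.map (Bialgebra.comulAlgHom k H) (AlgHom.id k H)
  let D2 : H ⊗[k] H →ₐ[k] H ⊗[k] (H ⊗[k] H) :=
    Algebra.TensorProduct.map (AlgHom.id k H) (Bialgebra.comulAlgHom k H)
  have as : ∀ x y, TensorProduct.assoc k H H H (x * y) =
      TensorProduct.assoc k H H H x * TensorProduct.assoc k H H H y := fun x y =>
    map_mul (Algebra.TensorProduct.assoc k k k H H H) x y
  have d1 : ∀ t, TensorProduct.map (Coalgebra.comul (R := k)) LinearMap.id t = D1 t := fun _ => rfl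
  have d2 : ∀ t, TensorProduct.map LinearMap.id (Coalgebra.comul (R := k)) t = D2 t := fun _ => rfl
  have r1 : ∀ t, (LinearMap.mulLeft k J ∘ₗ comul).rTensor H t = (J ⊗ₜ[k] (1 : H)) * D1 t := by
    intro t
    induction t with
    | zero => simp
    | add a b ha hb => simp only [map_add, ha, hb, mul_add]
    | tmul a b => simp [D1]
  have r2 : ∀ t, (LinearMap.mulLeft k J ∘ₗ comul).lTensor H t = ((1 : H) ⊗ₜ[k] J) * D2 t := by
    intro t
    induction t with
    | zero => simp
    | add a b ha hb => simp only [map_add, ha, hb, mul_add]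
    | tmul a b => simp [D2]
  rw [d1, d2] at hcoc
  have hco : ∀ c, TensorProduct.assoc k H H H (D1 (comul c)) = D2 (comul c) := fun c =>
    coassoc_apply c
  ext c
  simp only [LinearMap.comp_apply, LinearEquiv.coe_coe, LinearMap.mulLeft_apply]
  rw [r1, r2, map_mul D1, map_mul D2, ← mul_assoc, ← mul_assoc, as, hcoc, hco]

/-- the coalgebra `(H, J Δ, ε)` -/
abbrev twCoalgebra {k H : Type*} [Field k] [Ring H] [HopfAlgebra k H] (J : H ⊗[k] H)
    (hcoc : TensorProduct.assoc k H H H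
        ((J ⊗ₜ[k] (1 : H)) * (TensorProduct.map (Coalgebra.comul (R := k)) LinearMap.id J)) =
      ((1 : H) ⊗ₜ[k] J) * (TensorProduct.map LinearMap.id (Coalgebra.comul (R := k)) J))
    (hJ1 : TensorProduct.lid k H (TensorProduct.map (Coalgebra.counit (R := k)) LinearMap.id J)
      = 1)
    (hJ2 : TensorProduct.rid k H (TensorProduct.map LinearMap.id (Coalgebra.counit (R := k)) J)
      = 1) : Coalgebra k (TwC H) where
  comul := (LinearMap.mulLeft k J ∘ₗ comul : H →ₗ[k] H ⊗[k] H)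
  counit := (counit : H →ₗ[k] k)
  coassoc := twc_coassoc J hcoc
  rTensor_counit_comp_comul := by
    let E : H ⊗[k] H →ₐ[k] k ⊗[k] H :=
      Algebra.TensorProduct.map (Bialgebra.counitAlgHom k H) (AlgHom.id k H)
    have h1 : E J = 1 := (Algebra.TensorProduct.lid k H).injective (hJ1.trans (map_one _).symm)
    refine LinearMap.ext fun (c : H) => ?_
    change E (J * comul c) = 1 ⊗ₜ c
    rw [map_mul, h1, one_mul]
    exact rTensor_counit_comul c
  lTensor_counit_comp_comul := by
    let E : H ⊗[k] H →ₐ[k] H ⊗[k] k :=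
      Algebra.TensorProduct.map (AlgHom.id k H) (Bialgebra.counitAlgHom k H)
    have h1 : E J = 1 := (Algebra.TensorProduct.rid k k H).injective (hJ2.trans (map_one _).symm)
    refine LinearMap.ext fun (c : H) => ?_
    change E (J * comul c) = c ⊗ₜ 1
    rw [map_mul, h1, one_mul]
    exact lTensor_counit_comul c

end PartD

/-- for a finite-dimensional Hopf algebra `H` and a left twist `J` for `H`,
`exp₀(H^J) = exp₀(H)`.  Here `HJ` is a Hopf algebra identified with `H` as an algebra via
`e`, whose comultiplication is `Δ^J = J · Δ(-) · J⁻¹` and whose counit is that of `H`. -/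
theorem stmt8 (k H HJ : Type*) [Field k] [Ring H] [HopfAlgebra k H] [FiniteDimensional k H]
    [Ring HJ] [HopfAlgebra k HJ]
    (J J' : H ⊗[k] H)
    -- `J` is invertible with inverse `J'`:
    (hJJ' : J * J' = 1) (hJ'J : J' * J = 1)
    -- the (left) twist equation `(J ⊗ 1)·(Δ ⊗ id)(J) = (1 ⊗ J)·(id ⊗ Δ)(J)`:
    (hcoc : TensorProduct.assoc k H H H
        ((J ⊗ₜ[k] (1 : H)) * (TensorProduct.map (Coalgebra.comul (R := k)) LinearMap.id J)) =
      ((1 : H) ⊗ₜ[k] J) * (TensorProduct.map LinearMap.id (Coalgebra.comul (R := k)) J))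
    -- the counital conditions `(ε ⊗ id)(J) = (id ⊗ ε)(J) = 1`:
    (hJ1 : TensorProduct.lid k H (TensorProduct.map (Coalgebra.counit (R := k)) LinearMap.id J)
      = 1)
    (hJ2 : TensorProduct.rid k H (TensorProduct.map LinearMap.id (Coalgebra.counit (R := k)) J)
      = 1)
    -- `HJ` is `H` as an algebra ...
    (e : HJ ≃ₗ[k] H)
    (he_mul : ∀ x y : HJ, e (x * y) = e x * e y)
    (he_one : e 1 = 1)
    -- ... with the twisted comultiplication `Δ^J(h) = J Δ(h) J⁻¹` and the same counit:
    (he_comul : ∀ x : HJ,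
      TensorProduct.map e.toLinearMap e.toLinearMap (Coalgebra.comul x) =
        J * Coalgebra.comul (e x) * J')
    (he_counit : ∀ x : HJ, Coalgebra.counit (R := k) x = Coalgebra.counit (e x)) :
    exp0 k HJ = exp0 k H := by
  have : FiniteDimensional k HJ := Module.Finite.equiv e.symm
  letI := twCoalgebra J hcoc hJ1 hJ2
  let j : TwC H →ₗ[k] H := (LinearMap.id : H →ₗ[k] H)
  have : FiniteDimensional k (TwC H) := inferInstanceAs (FiniteDimensional k H)
  have hcore : ∀ n, _ := core_iff J J' j hJJ' hJ'J (1 : H) rfl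
    (fun c => LinearMap.congr_fun (TensorProduct.map_id (R := k) (M := H) (N := H))
      (J * Coalgebra.comul (R := k) (j c))) (fun c => rfl)
  let e2 : HJ ⊗[k] HJ ≃ₗ[k] H ⊗[k] H := TensorProduct.congr e e
  have hconj : ∀ x, e2 (tauD Coalgebra.comul x) = tauD (twComul J J') (e2 x) := by
    intro x
    induction x with
    | zero => simp
    | add a b ha hb => simp only [map_add, ha, hb]
    | tmul b v =>
      rw [tauD_tmul]
      have : e2 (b ⊗ₜ v) = e b ⊗ₜ e v := rfl
      rw [this, tauD_tmul]
      have h2 : twComul J J' (e b) =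
          TensorProduct.map e.toLinearMap e.toLinearMap (Coalgebra.comul b) := by
        rw [he_comul]; rfl
      rw [h2]
      generalize Coalgebra.comul (R := k) b = t
      induction t with
      | zero => simp
      | add a b ha hb => simp only [map_add, ha, hb, add_mul]
      | tmul a b => simp [e2, he_mul]
  have hpow : ∀ n x, e2 ((tauD Coalgebra.comul ^ n) x) = (tauD (twComul J J') ^ n) (e2 x) := by
    intro n
    induction n with
    | zero => intro x; rfl
    | succ n ih => intro x; rw [pow_succ, pow_succ, Module.End.mul_apply, Module.End.mul_apply, ih,
        hconj]
  have hiff : ∀ n, sweedlerPow k HJ n = convOne k HJ ↔ sweedlerPow k H n = convOne k H := by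
    intro n
    rw [sweedler_iff_tau, sweedler_iff_tau, ← hcore n]
    constructor
    · intro h
      refine LinearMap.ext fun y => ?_
      obtain ⟨x, rfl⟩ := e2.surjective y
      rw [← hpow, h]; rfl
    · intro h
      refine LinearMap.ext fun x => e2.injective ?_
      rw [hpow, h]; rfl
  unfold exp0
  simp only [hiff]
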